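/- Let A₁, A₂ be two self-dual subgroups of W with chosen extensions ψ_{A₁}, ψ_{A₂} of ψ, and let ω ∈ W satisfy ψ_{A₁}^ℬ((a,0))·ψ_{A₂}^ℬ((a,0))^{-1} = ψ^ℬ(⟨a,ω⟩) for all a ∈ A₁ ∩ A₂ (such ω exists). Then: (i) for each f ∈ V_{A₁}^ℬ and h ∈ H, the value ψ_{A₂}^ℬ((a,0))^{-1} f((ω,0)(a,0)h) depends only on the coset (A₁∩A₂)a of a ∈ A₂; (ii) the map I sending f to the function h ↦ Σ_{ā ∈ (A₁∩A₂)\A₂} ψ_{A₂}^ℬ((a,0))^{-1} f((ω,0)(a,0)h) (sum over coset representatives) is an isomorphism of ℬ[H]-modules from V_{A₁}^ℬ to V_{A₂}^ℬ; and (iii) Hom_{ℬ[H]}(V_{A₁}^ℬ, V_{A₂}^ℬ) = {λ·I : λ ∈ ℬ}, a free ℬ-module of rank 1. -/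

import Mathlib

set_option maxHeartbeats 1000000
set_option synthInstance.maxHeartbeats 1000000

noncomputable section

open scoped TensorProduct

/-! ## The base ring `𝒜`: the integral closure of `ℤ[1/p]` in a cyclotomic field -/

instance cycloAlgebra (p : ℕ) [NeZero p] (m : ℕ+) :
    Algebra (Localization.Away (p : ℤ)) (CyclotomicField m ℚ) :=
  (Localization.awayLift (algebraMap ℤ (CyclotomicField m ℚ)) _
    (by
      rw [map_natCast]
      have h1 : IsUnit ((p : ℕ) : ℚ) :=
        isUnit_iff_ne_zero.mpr (Nat.cast_ne_zero.mpr (NeZero.ne p))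
      have h2 := h1.map (algebraMap ℚ (CyclotomicField m ℚ))
      rwa [map_natCast] at h2)).toAlgebra

/-- The integral closure of `ℤ[1/p]` in the `m`-th cyclotomic field `ℚ(ζ_m)`. -/
def Aint (p : ℕ) [NeZero p] (m : ℕ+) :
    Subalgebra (Localization.Away (p : ℤ)) (CyclotomicField m ℚ) :=
  integralClosure (Localization.Away (p : ℤ)) (CyclotomicField m ℚ)

/-- The ring `𝒜` associated to a finite field of characteristic `p` : the integral
closure of `ℤ[1/p]` in `ℚ(ζ_p)`. -/
def AA (p : ℕ+) : Type := ↥(Aint (p : ℕ) p)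

instance (p : ℕ+) : CommRing (AA p) := inferInstanceAs (CommRing ↥(Aint (p : ℕ) p))

attribute [irreducible] AA

/-! ## The Heisenberg group -/

variable {F : Type*} [Field F] {W : Type*} [AddCommGroup W] [Module F W]

/-- The Heisenberg group attached to the bilinear form `β` : the set `W × F` with
multiplication `(w,t)(w',t') = (w+w', t+t'+½⟨w,w'⟩)`. -/
@[ext]
structure Heis (β : W →ₗ[F] W →ₗ[F] F) : Type _ where
  w : W
  t : F

namespace Heis

variable {β : W →ₗ[F] W →ₗ[F] F}

instance : Mul (Heis β) :=
  ⟨fun a b => ⟨a.w + b.w, a.t + b.t + (2 : F)⁻¹ * β a.w b.w⟩⟩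

instance : One (Heis β) := ⟨⟨0, 0⟩⟩

instance : Inv (Heis β) :=
  ⟨fun a => ⟨-a.w, -a.t + (2 : F)⁻¹ * β a.w a.w⟩⟩

@[simp] lemma mul_w (a b : Heis β) : (a * b).w = a.w + b.w := rfl
@[simp] lemma mul_t (a b : Heis β) :
    (a * b).t = a.t + b.t + (2 : F)⁻¹ * β a.w b.w := rfl
@[simp] lemma one_w : (1 : Heis β).w = 0 := rfl
@[simp] lemma one_t : (1 : Heis β).t = 0 := rfl
@[simp] lemma inv_w (a : Heis β) : a⁻¹.w = -a.w := rfl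
@[simp] lemma inv_t (a : Heis β) :
    a⁻¹.t = -a.t + (2 : F)⁻¹ * β a.w a.w := rfl

instance : Group (Heis β) where
  mul_assoc a b c := by
    ext
    · simp [add_assoc]
    · simp [map_add, LinearMap.add_apply]
      ring
  one_mul a := by ext <;> simp
  mul_one a := by ext <;> simp
  inv_mul_cancel a := by
    ext
    · simp
    · simp [map_neg, LinearMap.neg_apply]

end Heis

/-! ## The induced representation `V_A^ℬ = ind_{A_H}^H(ψ_A^ℬ)` -/

/-- The compactly induced representation `ind_{A_H}^H ψ_A^ℬ`, realised as the
`ℬ`-submodule of functions `f : H → ℬ` with `f(ah) = ψ_A^ℬ(a) f(h)` for `a ∈ A_H`. -/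
def IndV (β : W →ₗ[F] W →ₗ[F] F) (ℬ : Type*) [CommRing ℬ] (A : AddSubgroup W)
    (χ : Heis β → ℬˣ) : Submodule ℬ (Heis β → ℬ) where
  carrier := {f | ∀ a : Heis β, a.w ∈ A → ∀ h : Heis β, f (a * h) = (χ a : ℬ) * f h}
  add_mem' := by
    intro f g hf hg a ha h
    simp only [Pi.add_apply, hf a ha h, hg a ha h, mul_add]
  zero_mem' := by intro a ha h; simp
  smul_mem' := by
    intro c f hf a ha h
    simp only [Pi.smul_apply, smul_eq_mul, hf a ha h]
    ring

/-- Right translation action of `h₀ ∈ H` on functions `H → ℬ`. -/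
def hAct (β : W →ₗ[F] W →ₗ[F] F) (ℬ : Type*) [CommRing ℬ] (h₀ : Heis β) :
    (Heis β → ℬ) →ₗ[ℬ] (Heis β → ℬ) where
  toFun f := fun h => f (h * h₀)
  map_add' _ _ := rfl
  map_smul' _ _ := rfl

lemma hAct_mem (β : W →ₗ[F] W →ₗ[F] F) (ℬ : Type*) [CommRing ℬ] (A : AddSubgroup W)
    (χ : Heis β → ℬˣ) (h₀ : Heis β) (f : Heis β → ℬ) (hf : f ∈ IndV β ℬ A χ) :
    hAct β ℬ h₀ f ∈ IndV β ℬ A χ := by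
  intro a ha h
  simpa [hAct, mul_assoc] using hf a ha (h * h₀)

/-- The action `ρ` of the Heisenberg group on `V_A^ℬ`. -/
def hActV (β : W →ₗ[F] W →ₗ[F] F) (ℬ : Type*) [CommRing ℬ] (A : AddSubgroup W)
    (χ : Heis β → ℬˣ) (h₀ : Heis β) :
    ↥(IndV β ℬ A χ) →ₗ[ℬ] ↥(IndV β ℬ A χ) :=
  (hAct β ℬ h₀).restrict fun f hf => hAct_mem β ℬ A χ h₀ f hf

/-! ## The symplectic group and its action on the Heisenberg group -/

/-- Action of a linear automorphism `g` on the Heisenberg group: `g·(w,t) = (gw,t)`. -/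
def gHeis (β : W →ₗ[F] W →ₗ[F] F) (g : W ≃ₗ[F] W) : Heis β → Heis β :=
  fun h => ⟨g h.w, h.t⟩

/-- The symplectic group `Sp(W)` of the form `β`, as a subgroup of the linear
automorphism group of `W`. -/
def SpGrp (β : W →ₗ[F] W →ₗ[F] F) : Subgroup (W ≃ₗ[F] W) where
  carrier := {g | ∀ u v : W, β (g u) (g v) = β u v}
  one_mem' := fun _ _ => rfl
  mul_mem' := by
    intro g g' hg hg' u v
    have h : ∀ x, (g * g') x = g (g' x) := fun _ => rfl
    rw [h, h, hg, hg']
  inv_mem' := by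
    intro g hg u v
    have h1 := hg (g⁻¹ u) (g⁻¹ v)
    have h2 : ∀ x, g (g⁻¹ x) = x := fun x => g.apply_symm_apply x
    rw [h2, h2] at h1
    exact h1.symm

/-- The defining condition of the metaplectic group over `ℬ` : pairs `(g, M)` with
`g ∈ Sp(W)` and `M ∘ ρ(h) = ρ(g·h) ∘ M` for all `h ∈ H`. -/
def MetaCond (β : W →ₗ[F] W →ₗ[F] F) (ℬ : Type*) [CommRing ℬ] (A : AddSubgroup W)
    (χ : Heis β → ℬˣ)
    (x : (W ≃ₗ[F] W) × (↥(IndV β ℬ A χ) ≃ₗ[ℬ] ↥(IndV β ℬ A χ))) : Prop :=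
  (∀ u v : W, β (x.1 u) (x.1 v) = β u v) ∧
    ∀ (h₀ : Heis β) (f : ↥(IndV β ℬ A χ)),
      x.2 (hActV β ℬ A χ h₀ f) = hActV β ℬ A χ (gHeis β x.1 h₀) (x.2 f)

/-- The character `ψ_A^ℬ = φ ∘ ψ_A` of `A_H` with values in `ℬˣ`, obtained from a
character with values in `𝒜ˣ` via the structure morphism `φ : 𝒜 → ℬ`. -/
def chB (p : ℕ+) (ℬ : Type*) [CommRing ℬ] [Algebra (AA p) ℬ]
    {β : W →ₗ[F] W →ₗ[F] F} (ψA : Heis β → (AA p)ˣ) : Heis β → ℬˣ :=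
  fun h => Units.map (algebraMap (AA p) ℬ).toMonoidHom (ψA h)

/-- The character `ψ^ℬ = φ ∘ ψ` of `F` with values in `ℬˣ`. -/
def psB (p : ℕ+) (ℬ : Type*) [CommRing ℬ] [Algebra (AA p) ℬ]
    (ψ : F → (AA p)ˣ) : F → ℬˣ :=
  fun t => Units.map (algebraMap (AA p) ℬ).toMonoidHom (ψ t)

/-! ## Arithmetic of the base ring and character sums -/

section Arithmetic

instance AA.instIsDomain (p : ℕ+) : IsDomain (AA p) := by
  with_unfolding_all exact inferInstanceAs (IsDomain ↥(Aint (p : ℕ) p))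

lemma AA.isUnit_natCast (p : ℕ+) : IsUnit (((p : ℕ) : ℕ) : AA p) := by
  have h : IsUnit (((p : ℕ) : ℕ) : ↥(Aint (p : ℕ) p)) := by
    have h1 : IsUnit (algebraMap ℤ (Localization.Away (((p : ℕ) : ℕ) : ℤ)) ((p : ℕ) : ℤ)) :=
      IsLocalization.Away.algebraMap_isUnit _
    have h2 := h1.map (algebraMap (Localization.Away (((p : ℕ) : ℕ) : ℤ)) ↥(Aint (p : ℕ) p))
    simpa using h2
  with_unfolding_all exact h

lemma isUnit_natCard_addSubgroup (p : ℕ+) (ℬ : Type*) [CommRing ℬ] [Algebra (AA p) ℬ]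
    (F : Type*) [Field F] [Fintype F] [CharP F (p : ℕ)]
    {W : Type*} [AddCommGroup W] [Module F W] [FiniteDimensional F W] (B : AddSubgroup W) :
    IsUnit ((Nat.card B : ℕ) : ℬ) := by
  obtain ⟨n, -, hn⟩ := FiniteField.card F (p : ℕ)
  have hW : Nat.card W = (p : ℕ) ^ ((n : ℕ) * Module.finrank F W) := by
    rw [Module.natCard_eq_pow_finrank (K := F), Nat.card_eq_fintype_card, hn, pow_mul]
  have hB := AddSubgroup.card_addSubgroup_dvd_card B
  rw [hW] at hB
  have hp : IsUnit (((p : ℕ) : ℕ) : ℬ) := by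
    simpa using (AA.isUnit_natCast p).map (algebraMap (AA p) ℬ)
  have hpow : IsUnit ((((p : ℕ) ^ ((n : ℕ) * Module.finrank F W) : ℕ)) : ℬ) := by
    rw [Nat.cast_pow]
    exact hp.pow _
  exact isUnit_of_dvd_unit (Nat.cast_dvd_cast hB) hpow

variable {p : ℕ+} {F : Type*} [Field F] {W : Type*} [AddCommGroup W] [Module F W]

lemma map_zero_of_map_add {ψ : F → (AA p)ˣ} (hψ : ∀ x y : F, ψ (x + y) = ψ x * ψ y) :
    ψ 0 = 1 := by
  have h := hψ 0 0
  rw [add_zero] at h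
  exact (mul_eq_left.mp h.symm)

lemma sum_addSubgroup_eq_zero {ψ : F → (AA p)ˣ} (hψ : ∀ x y : F, ψ (x + y) = ψ x * ψ y)
    (B : AddSubgroup W) [Fintype B] (l : W →ₗ[F] F) (hl : ∃ b ∈ B, ψ (l b) ≠ 1) :
    ∑ b : B, ((ψ (l b) : (AA p)ˣ) : AA p) = 0 := by
  let χ : AddChar B (AA p) :=
    { toFun := fun b => ((ψ (l b) : (AA p)ˣ) : AA p)
      map_zero_eq_one' := by simp [map_zero_of_map_add hψ]
      map_add_eq_mul' := fun a b => by simp [hψ] }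
  have hχ : χ ≠ 0 := by
    obtain ⟨b, hb, h⟩ := hl
    intro h0
    apply h
    have := DFunLike.congr_fun h0 (⟨b, hb⟩ : B)
    exact Units.ext this
  exact AddChar.sum_eq_zero_of_ne_one hχ

lemma exists_ne_one_of_ne_zero {β : W →ₗ[F] W →ₗ[F] F} (halt : ∀ v : W, β v v = 0)
    (hnd : ∀ v : W, (∀ u : W, β v u = 0) → v = 0) {ψ : F → (AA p)ˣ}
    (hψnt : ∃ x : F, ψ x ≠ 1) {u : W} (hu : u ≠ 0) : ∃ x, ψ (β.flip u x) ≠ 1 := by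
  obtain ⟨t, ht⟩ := hψnt
  have hex : ∃ x, β u x ≠ 0 := by
    by_contra! h
    exact hu (hnd u h)
  obtain ⟨x, hx⟩ := hex
  have hneg : β x u = -β u x := (LinearMap.IsAlt.neg halt u x).symm
  refine ⟨(t / β x u) • x, ?_⟩
  have hx' : β x u ≠ 0 := by simpa [hneg] using hx
  simpa [div_mul_cancel₀ _ hx'] using ht

/-- Double orthogonality for subgroups of `W`. -/
lemma mem_of_perp_perp [Fintype F] [CharP F (p : ℕ)] [FiniteDimensional F W]
    {β : W →ₗ[F] W →ₗ[F] F} (halt : ∀ v : W, β v v = 0)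
    (hnd : ∀ v : W, (∀ u : W, β v u = 0) → v = 0) {ψ : F → (AA p)ˣ}
    (hψ : ∀ x y : F, ψ (x + y) = ψ x * ψ y) (hψnt : ∃ x : F, ψ x ≠ 1)
    (B C : AddSubgroup W) (hBC : ∀ x, (∀ b ∈ B, ψ (β x b) = 1) ↔ x ∈ C) {v : W}
    (hv : ∀ x ∈ C, ψ (β x v) = 1) : v ∈ B := by
  classical
  have : Finite W := Module.finite_of_finite F
  have : Fintype W := Fintype.ofFinite W
  by_contra hvB
  have hrow : ∀ x : W, ∑ b : B, ((ψ (β x (b + v)) : (AA p)ˣ) : AA p) =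
      if x ∈ C then (Nat.card B : AA p) else 0 := by
    intro x
    simp only [map_add, hψ, Units.val_mul, ← Finset.sum_mul]
    split_ifs with hx
    · have h1 : ∀ b : B, ψ (β x b) = 1 := fun b => (hBC x).2 hx b b.2
      simp [h1, hv x hx]
    · rw [sum_addSubgroup_eq_zero hψ B (β x), zero_mul]
      by_contra! h
      exact hx ((hBC x).1 h)
  have hcol : ∀ b : B, ∑ x : W, ((ψ (β x (b + v)) : (AA p)ˣ) : AA p) = 0 := by
    intro b
    have hne : (b : W) + v ≠ 0 := fun h =>
      hvB (by rw [← neg_eq_of_add_eq_zero_right h]; exact B.neg_mem b.2)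
    obtain ⟨x, hx⟩ := exists_ne_one_of_ne_zero halt hnd hψnt hne
    have h0 := sum_addSubgroup_eq_zero hψ (⊤ : AddSubgroup W) (β.flip (b + v))
      ⟨x, AddSubgroup.mem_top x, hx⟩
    rw [← h0]
    exact Fintype.sum_equiv AddSubgroup.topEquiv.symm.toEquiv _ _ (fun _ => rfl)
  have hS : ∑ x : W, ∑ b : B, ((ψ (β x (b + v)) : (AA p)ˣ) : AA p) = 0 := by
    rw [Finset.sum_comm]
    exact Finset.sum_eq_zero fun b _ => hcol b
  simp only [hrow] at hS
  rw [← Finset.sum_filter, Finset.sum_const, nsmul_eq_mul] at hS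
  have hC : (Finset.univ.filter (· ∈ C)).card = Nat.card C := by
    rw [Nat.card_eq_fintype_card, Fintype.card_subtype]
  rw [hC] at hS
  exact ((isUnit_natCard_addSubgroup p (AA p) F C).mul
    (isUnit_natCard_addSubgroup p (AA p) F B)).ne_zero hS

end Arithmetic

/-! ## Models of the Heisenberg representation -/

/-- A self-dual subgroup `A` of `W` with an extension `χ` of `ψ` to a character of `A_H`. -/
structure IsModel {p : ℕ+} {β : W →ₗ[F] W →ₗ[F] F} (ψ : F → (AA p)ˣ) (A : AddSubgroup W)
    (χ : Heis β → (AA p)ˣ) : Prop where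
  perp : ∀ v : W, (∀ a ∈ A, ψ (β v a) = 1) ↔ v ∈ A
  mul : ∀ a b : Heis β, a.w ∈ A → b.w ∈ A → χ (a * b) = χ a * χ b
  central : ∀ t : F, χ ⟨0, t⟩ = ψ t

/-- The element `w₀` measures the discrepancy of two extensions of `ψ` on `A₁ ∩ A₂`. -/
def IsTwist (p : ℕ+) (ℬ : Type*) [CommRing ℬ] [Algebra (AA p) ℬ] {β : W →ₗ[F] W →ₗ[F] F}
    (ψ : F → (AA p)ˣ) (A₁ A₂ : AddSubgroup W) (χ₁ χ₂ : Heis β → (AA p)ˣ) (w₀ : W) : Prop :=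
  ∀ a, a ∈ A₁ → a ∈ A₂ → chB p ℬ χ₁ ⟨a, 0⟩ = chB p ℬ χ₂ ⟨a, 0⟩ * psB p ℬ ψ (β a w₀)

/-- The intertwining sum over all of `A`. -/
def fullSum {β : W →ₗ[F] W →ₗ[F] F} {ℬ : Type*} [CommRing ℬ] (A : AddSubgroup W) [Fintype A]
    (χ : Heis β → ℬˣ) (w₀ : W) : (Heis β → ℬ) →ₗ[ℬ] (Heis β → ℬ) where
  toFun f h := ∑ a : A, ((χ ⟨a, 0⟩)⁻¹ : ℬˣ) * f (⟨w₀, 0⟩ * ⟨a, 0⟩ * h)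
  map_add' f g := by
    funext h
    simp [mul_add, Finset.sum_add_distrib]
  map_smul' c f := by
    funext h
    simp [Finset.mul_sum, mul_left_comm]

open Classical in
/-- The function supported on `A_H` and equal to `χ` there. -/
def deltaFun {β : W →ₗ[F] W →ₗ[F] F} {ℬ : Type*} [CommRing ℬ] (A : AddSubgroup W)
    (χ : Heis β → ℬˣ) : Heis β → ℬ :=
  fun h => if h.w ∈ A then (χ h : ℬ) else 0

section Models

variable {p : ℕ+} {β : W →ₗ[F] W →ₗ[F] F} {ℬ : Type*} [CommRing ℬ] [Algebra (AA p) ℬ]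
  {ψ : F → (AA p)ˣ} {A A₁ A₂ : AddSubgroup W} {χ χ₁ χ₂ : Heis β → (AA p)ˣ} {w₀ : W}

lemma psB_add (hψ : ∀ x y : F, ψ (x + y) = ψ x * ψ y) (x y : F) :
    psB p ℬ ψ (x + y) = psB p ℬ ψ x * psB p ℬ ψ y := by
  simp [psB, hψ]

lemma psB_zero (hψ : ∀ x y : F, ψ (x + y) = ψ x * ψ y) : psB p ℬ ψ 0 = 1 := by
  simpa using psB_add (ℬ := ℬ) hψ 0 0

lemma IsModel.chB_mul (h : IsModel ψ A χ) {a b : Heis β} (ha : a.w ∈ A) (hb : b.w ∈ A) :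
    chB p ℬ χ (a * b) = chB p ℬ χ a * chB p ℬ χ b := by
  simp [chB, h.mul a b ha hb]

lemma IsModel.chB_central (h : IsModel ψ A χ) (t : F) :
    chB p ℬ χ ⟨0, t⟩ = psB p ℬ ψ t := by
  simp [chB, psB, h.central]

lemma Heis.mk_eq_central_mul (w : W) (s t : F) :
    (⟨w, t + s⟩ : Heis β) = ⟨0, t⟩ * ⟨w, s⟩ := by
  ext <;> simp

lemma IsModel.chB_mk_add (h : IsModel ψ A χ) {w : W} (hw : w ∈ A) (s t : F) :
    chB p ℬ χ ⟨w, t + s⟩ = psB p ℬ ψ t * chB p ℬ χ ⟨w, s⟩ := by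
  rw [Heis.mk_eq_central_mul, h.chB_mul A.zero_mem hw, h.chB_central]

lemma IsModel.apply_mk_add (h : IsModel ψ A χ) {f : Heis β → ℬ}
    (hf : f ∈ IndV β ℬ A (chB p ℬ χ)) (w : W) (s t : F) :
    f ⟨w, t + s⟩ = (psB p ℬ ψ t : ℬ) * f ⟨w, s⟩ := by
  rw [Heis.mk_eq_central_mul, hf _ A.zero_mem, h.chB_central]

lemma IsTwist.symm (hψ : ∀ x y : F, ψ (x + y) = ψ x * ψ y)
    (hw : IsTwist p ℬ ψ A₁ A₂ χ₁ χ₂ w₀) : IsTwist p ℬ ψ A₂ A₁ χ₂ χ₁ (-w₀) := by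
  intro a h2 h1
  rw [hw a h1 h2, mul_assoc, ← psB_add hψ]
  simp [psB_zero hψ]

lemma isTwist_refl (hψ : ∀ x y : F, ψ (x + y) = ψ x * ψ y) :
    IsTwist p ℬ ψ A A χ χ 0 := by
  intro a _ _
  simp [psB_zero hψ]

lemma IsModel.inv_mul_apply_eq (halt : ∀ v : W, β v v = 0) (h2F : (2 : F) ≠ 0)
    (hψ : ∀ x y : F, ψ (x + y) = ψ x * ψ y)
    (hm₁ : IsModel ψ A₁ χ₁) (hm₂ : IsModel ψ A₂ χ₂) (hw : IsTwist p ℬ ψ A₁ A₂ χ₁ χ₂ w₀)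
    {f : Heis β → ℬ} (hf : f ∈ IndV β ℬ A₁ (chB p ℬ χ₁)) (h : Heis β) {a a' : W}
    (ha : a ∈ A₂) (ha' : a' ∈ A₂) (haa : a - a' ∈ A₁) :
    ((chB p ℬ χ₂ ⟨a, 0⟩)⁻¹ : ℬˣ) * f (⟨w₀, 0⟩ * ⟨a, 0⟩ * h) =
      ((chB p ℬ χ₂ ⟨a', 0⟩)⁻¹ : ℬˣ) * f (⟨w₀, 0⟩ * ⟨a', 0⟩ * h) := by
  obtain ⟨b, rfl⟩ : ∃ b, a = b + a' := ⟨a - a', by abel⟩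
  rw [add_sub_cancel_right] at haa
  have hb2 : b ∈ A₂ := by simpa using A₂.sub_mem ha ha'
  have hneg : β w₀ b = -β b w₀ := (LinearMap.IsAlt.neg halt b w₀).symm
  have hχ : chB p ℬ χ₂ ⟨b, 0⟩ * chB p ℬ χ₂ ⟨a', 0⟩ =
      psB p ℬ ψ ((2 : F)⁻¹ * β b a') * chB p ℬ χ₂ ⟨b + a', 0⟩ := by
    rw [← hm₂.chB_mul hb2 ha', ← hm₂.chB_mk_add ha]
    congr 1
    ext <;> simp
  have hprod : (⟨w₀, 0⟩ * ⟨b, 0⟩ * ⟨a', 0⟩ * h : Heis β) =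
      ⟨b, -β b w₀ + 0⟩ * (⟨w₀, 0⟩ * ⟨a', 0⟩ * h) := by
    ext
    · simp only [Heis.mul_w]
      abel
    · simp only [Heis.mul_w, Heis.mul_t, map_add, LinearMap.add_apply, hneg]
      field_simp
      ring
  have hprod' : (⟨w₀, 0⟩ * ⟨b, 0⟩ * ⟨a', 0⟩ * h : Heis β) =
      ⟨(⟨w₀, 0⟩ * ⟨b + a', 0⟩ * h : Heis β).w,
        (2 : F)⁻¹ * β b a' + (⟨w₀, 0⟩ * ⟨b + a', 0⟩ * h : Heis β).t⟩ := by
    ext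
    · simp only [Heis.mul_w]
      abel
    · simp only [Heis.mul_w, Heis.mul_t, map_add, LinearMap.add_apply]
      ring
  have hval : (psB p ℬ ψ ((2 : F)⁻¹ * β b a') : ℬ) * f (⟨w₀, 0⟩ * ⟨b + a', 0⟩ * h) =
      (chB p ℬ χ₂ ⟨b, 0⟩ : ℬ) * f (⟨w₀, 0⟩ * ⟨a', 0⟩ * h) := by
    have h1 := hm₁.apply_mk_add hf (⟨w₀, 0⟩ * ⟨b + a', 0⟩ * h : Heis β).w
      (⟨w₀, 0⟩ * ⟨b + a', 0⟩ * h : Heis β).t ((2 : F)⁻¹ * β b a')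
    rw [← hprod', hprod, hf _ haa, hm₁.chB_mk_add haa, hw b haa hb2] at h1
    refine h1.symm.trans ?_
    have h3 : psB p ℬ ψ (-β b w₀) * psB p ℬ ψ (β b w₀) = 1 := by
      rw [← psB_add hψ, neg_add_cancel, psB_zero hψ]
    congr 1
    rw [mul_left_comm, h3, mul_one]
  rw [← Units.mul_right_inj (psB p ℬ ψ ((2 : F)⁻¹ * β b a')), mul_left_comm, hval,
    ← mul_assoc, ← mul_assoc, ← Units.val_mul, ← Units.val_mul]
  congr 2
  rw [inv_mul_eq_iff_eq_mul, mul_left_comm, ← mul_assoc, eq_mul_inv_iff_mul_eq, hχ]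

lemma deltaFun_mem (hm : IsModel ψ A χ) :
    deltaFun A (chB p ℬ χ) ∈ IndV β ℬ A (chB p ℬ χ) := by
  intro a ha h
  have hiff : (a * h).w ∈ A ↔ h.w ∈ A := A.add_mem_cancel_left ha
  by_cases hh : h.w ∈ A
  · simp only [deltaFun, hiff, hh, if_true, hm.chB_mul ha hh, Units.val_mul]
  · simp only [deltaFun, hiff, hh, if_false, mul_zero]

lemma deltaFun_mul_right (hm : IsModel ψ A χ) {a : Heis β} (ha : a.w ∈ A) (h : Heis β) :
    deltaFun A (chB p ℬ χ) (h * a) = (chB p ℬ χ a : ℬ) * deltaFun A (chB p ℬ χ) h := by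
  have hiff : (h * a).w ∈ A ↔ h.w ∈ A := A.add_mem_cancel_right ha
  by_cases hh : h.w ∈ A
  · simp only [deltaFun, hiff, hh, if_true, hm.chB_mul hh ha, Units.val_mul, mul_comm]
  · simp only [deltaFun, hiff, hh, if_false, mul_zero]

lemma fullSum_mem [Fintype A₂] (hm₁ : IsModel ψ A₁ χ₁) (hm₂ : IsModel ψ A₂ χ₂) (w₀ : W)
    {f : Heis β → ℬ} (hf : f ∈ IndV β ℬ A₁ (chB p ℬ χ₁)) :
    fullSum A₂ (chB p ℬ χ₂) w₀ f ∈ IndV β ℬ A₂ (chB p ℬ χ₂) := by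
  rintro ⟨b, t⟩ hb h
  simp only at hb
  simp only [fullSum, LinearMap.coe_mk, AddHom.coe_mk, Finset.mul_sum]
  refine Fintype.sum_equiv (Equiv.addRight (⟨b, hb⟩ : A₂)) _ _ fun a => ?_
  simp only [Equiv.coe_addRight, AddSubgroup.coe_add]
  have hχ : chB p ℬ χ₂ ⟨a, 0⟩ * chB p ℬ χ₂ ⟨b, t⟩ =
      psB p ℬ ψ (t + (2 : F)⁻¹ * β a b) * chB p ℬ χ₂ ⟨a + b, 0⟩ := by
    rw [← hm₂.chB_mul a.2 hb, ← hm₂.chB_mk_add (A₂.add_mem a.2 hb)]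
    congr 1
    ext <;> simp
  have hprod : (⟨w₀, 0⟩ * ⟨a, 0⟩ * (⟨b, t⟩ * h) : Heis β) =
      ⟨(⟨w₀, 0⟩ * ⟨a + b, 0⟩ * h : Heis β).w,
        (t + (2 : F)⁻¹ * β a b) + (⟨w₀, 0⟩ * ⟨a + b, 0⟩ * h : Heis β).t⟩ := by
    ext
    · simp only [Heis.mul_w]
      abel
    · simp only [Heis.mul_w, Heis.mul_t, map_add, LinearMap.add_apply]
      ring
  rw [hprod, hm₁.apply_mk_add hf, ← mul_assoc, ← mul_assoc, ← Units.val_mul, ← Units.val_mul]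
  congr 2
  rw [inv_mul_eq_iff_eq_mul, ← mul_assoc, hχ, mul_inv_cancel_right]

/-- The intertwining sum as a map between models. -/
def fullSumV [Fintype A₂] (hm₁ : IsModel ψ A₁ χ₁) (hm₂ : IsModel ψ A₂ χ₂) (w₀ : W) :
    ↥(IndV β ℬ A₁ (chB p ℬ χ₁)) →ₗ[ℬ] ↥(IndV β ℬ A₂ (chB p ℬ χ₂)) :=
  (fullSum A₂ (chB p ℬ χ₂) w₀).restrict fun _ hf => fullSum_mem hm₁ hm₂ w₀ hf

lemma fullSumV_hActV [Fintype A₂] (hm₁ : IsModel ψ A₁ χ₁) (hm₂ : IsModel ψ A₂ χ₂) (w₀ : W)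
    (h₀ : Heis β) (f : ↥(IndV β ℬ A₁ (chB p ℬ χ₁))) :
    fullSumV hm₁ hm₂ w₀ (hActV β ℬ A₁ (chB p ℬ χ₁) h₀ f) =
      hActV β ℬ A₂ (chB p ℬ χ₂) h₀ (fullSumV hm₁ hm₂ w₀ f) := by
  ext h
  simp [fullSumV, fullSum, hActV, hAct, mul_assoc]

/-- The generator of the model attached to `A`. -/
def deltaV (hm : IsModel ψ A χ) : ↥(IndV β ℬ A (chB p ℬ χ)) :=
  ⟨deltaFun A (chB p ℬ χ), deltaFun_mem hm⟩

lemma hActV_deltaV (hm : IsModel ψ A χ) {a : Heis β} (ha : a.w ∈ A) :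
    hActV β ℬ A (chB p ℬ χ) a (deltaV hm) = (chB p ℬ χ a : ℬ) • deltaV hm := by
  ext h
  exact deltaFun_mul_right hm ha h

lemma natCard_smul_eq_sum_hActV_deltaV [Fintype W] (hm : IsModel ψ A χ)
    (f : ↥(IndV β ℬ A (chB p ℬ χ))) :
    (Nat.card A : ℬ) • f = ∑ w : W, (f : Heis β → ℬ) ⟨w, 0⟩ •
      hActV β ℬ A (chB p ℬ χ) (⟨w, 0⟩ : Heis β)⁻¹ (deltaV hm) := by
  classical
  ext h
  have hterm : ∀ w : W, (f : Heis β → ℬ) ⟨w, 0⟩ * deltaFun A (chB p ℬ χ) (h * (⟨w, 0⟩)⁻¹) =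
      if h.w - w ∈ A then (f : Heis β → ℬ) h else 0 := by
    intro w
    have hiff : (h * (⟨w, 0⟩ : Heis β)⁻¹).w ∈ A ↔ h.w - w ∈ A := by
      rw [Heis.mul_w, Heis.inv_w, sub_eq_add_neg]
    by_cases hh : h.w - w ∈ A
    · have h1 := f.2 _ (hiff.2 hh) ⟨w, 0⟩
      rw [inv_mul_cancel_right] at h1
      simp only [deltaFun, if_pos (hiff.2 hh), if_pos hh, h1, mul_comm]
    · simp only [deltaFun, if_neg (mt hiff.1 hh), if_neg hh, mul_zero]
  have hcard : (Finset.univ.filter fun w : W => h.w - w ∈ A).card = Nat.card A := by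
    rw [Nat.card_eq_fintype_card, ← Fintype.card_subtype]
    exact Fintype.card_congr ((Equiv.subLeft h.w).subtypeEquiv fun w => by simp)
  simp only [Submodule.coe_smul, Submodule.coe_sum, Pi.smul_apply, Finset.sum_apply, smul_eq_mul]
  refine Eq.trans ?_ (Finset.sum_congr rfl fun w _ => (hterm w).symm)
  rw [← Finset.sum_filter, Finset.sum_const, hcard, nsmul_eq_mul]

lemma fullSum_deltaFun [Fintype A₂] (halt : ∀ v : W, β v v = 0) (h2F : (2 : F) ≠ 0)
    (hψ : ∀ x y : F, ψ (x + y) = ψ x * ψ y)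
    (hm₁ : IsModel ψ A₁ χ₁) (hw : IsTwist p ℬ ψ A₁ A₂ χ₁ χ₂ w₀) :
    fullSum A₂ (chB p ℬ χ₂) w₀ (deltaFun A₁ (chB p ℬ χ₁)) ⟨-w₀, 0⟩ =
      (Nat.card ↥(A₁ ⊓ A₂) : ℬ) := by
  classical
  have hterm : ∀ a : A₂, ((chB p ℬ χ₂ ⟨a, 0⟩)⁻¹ : ℬˣ) *
      deltaFun A₁ (chB p ℬ χ₁) (⟨w₀, 0⟩ * ⟨a, 0⟩ * ⟨-w₀, 0⟩) =
        if (a : W) ∈ A₁ then (1 : ℬ) else 0 := by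
    intro a
    have hneg : β w₀ a = -β a w₀ := (LinearMap.IsAlt.neg halt _ _).symm
    have hprod : (⟨w₀, 0⟩ * ⟨a, 0⟩ * ⟨-w₀, 0⟩ : Heis β) = ⟨a, -β a w₀ + 0⟩ := by
      ext
      · simp
      · simp only [Heis.mul_w, Heis.mul_t, map_add, LinearMap.add_apply, map_neg, hneg, halt]
        field_simp
        ring
    rw [hprod]
    by_cases ha : (a : W) ∈ A₁
    · have h3 : psB p ℬ ψ (-β a w₀) * psB p ℬ ψ (β a w₀) = 1 := by
        rw [← psB_add hψ, neg_add_cancel, psB_zero hψ]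
      simp only [deltaFun, if_pos ha]
      rw [hm₁.chB_mk_add ha, hw a ha a.2, mul_left_comm, h3, mul_one, Units.inv_mul]
    · simp only [deltaFun, if_neg ha, mul_zero]
  have hcard : (Finset.univ.filter fun a : A₂ => (a : W) ∈ A₁).card = Nat.card ↥(A₁ ⊓ A₂) := by
    rw [← Fintype.card_subtype, ← Nat.card_eq_fintype_card]
    exact Nat.card_congr ((Equiv.subtypeSubtypeEquivSubtypeInter (· ∈ A₂) (· ∈ A₁)).trans
      (Equiv.subtypeEquivRight fun x => by simp [AddSubgroup.mem_inf, and_comm]))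
  refine (Finset.sum_congr rfl fun a _ => hterm a).trans ?_
  rw [← Finset.sum_filter, Finset.sum_const, hcard, nsmul_one]

lemma sum_eq_natCard_mul_sum_representatives [Fintype A₂] [Finite ↥(A₁ ⊓ A₂)] {R : Finset W}
    (hR₁ : ∀ r ∈ R, r ∈ A₂) (hR₂ : ∀ a ∈ A₂, ∃! r : W, r ∈ R ∧ a - r ∈ A₁) {g : W → ℬ}
    (hg : ∀ a a', a ∈ A₂ → a' ∈ A₂ → a - a' ∈ A₁ → g a = g a') :
    ∑ a : A₂, g a = (Nat.card ↥(A₁ ⊓ A₂) : ℬ) * ∑ r ∈ R, g r := by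
  have : Fintype ↥(A₁ ⊓ A₂) := Fintype.ofFinite _
  let e : ↥(A₁ ⊓ A₂) × R → A₂ := fun x =>
    ⟨x.1 + x.2, A₂.add_mem (AddSubgroup.mem_inf.1 x.1.2).2 (hR₁ _ x.2.2)⟩
  have he : Function.Bijective e := by
    constructor
    · rintro ⟨⟨b, hb⟩, ⟨r, hr⟩⟩ ⟨⟨b', hb'⟩, ⟨r', hr'⟩⟩ h
      have h' : b + r = b' + r' := congrArg Subtype.val h
      obtain ⟨s, -, hs⟩ := hR₂ (b + r)
        (A₂.add_mem (AddSubgroup.mem_inf.1 hb).2 (hR₁ _ hr))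
      have h1 : r = s := hs r ⟨hr, by simpa using (AddSubgroup.mem_inf.1 hb).1⟩
      have h2 : r' = s := hs r' ⟨hr', by simpa [h'] using (AddSubgroup.mem_inf.1 hb').1⟩
      obtain rfl : r = r' := h1.trans h2.symm
      obtain rfl : b = b' := add_right_cancel h'
      rfl
    · rintro ⟨a, ha⟩
      obtain ⟨r, ⟨hr, har⟩, -⟩ := hR₂ a ha
      exact ⟨⟨⟨a - r, AddSubgroup.mem_inf.2 ⟨har, A₂.sub_mem ha (hR₁ _ hr)⟩⟩, ⟨r, hr⟩⟩,
        Subtype.ext (sub_add_cancel a r)⟩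
  rw [← Fintype.sum_bijective e he (fun x => g x.2) _ fun x => ?_]
  · simp only [Fintype.sum_prod_type]
    rw [Finset.sum_const, Finset.card_univ, nsmul_eq_mul,
      Nat.card_eq_fintype_card, Finset.sum_coe_sort R g]
  · refine (hg _ _ (e x).2 (hR₁ _ x.2.2) ?_).symm
    simpa [e] using (AddSubgroup.mem_inf.1 x.1.2).1

section Finite

variable [Fintype F] [CharP F (p : ℕ)] [FiniteDimensional F W]

/-- An element of `V_{A₂}` on which `A₁` acts through `χ₁` is determined by its value at `-w₀`. -/
lemma eq_zero_of_apply_neg_eq_zero (halt : ∀ v : W, β v v = 0)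
    (hnd : ∀ v : W, (∀ u : W, β v u = 0) → v = 0) (h2F : (2 : F) ≠ 0)
    (hψ : ∀ x y : F, ψ (x + y) = ψ x * ψ y) (hψnt : ∃ x : F, ψ x ≠ 1)
    (hm₁ : IsModel ψ A₁ χ₁) (hm₂ : IsModel ψ A₂ χ₂) (hw : IsTwist p ℬ ψ A₁ A₂ χ₁ χ₂ w₀)
    {g : Heis β → ℬ} (hg : g ∈ IndV β ℬ A₂ (chB p ℬ χ₂))
    (hg₁ : ∀ a : Heis β, a.w ∈ A₁ → ∀ h, g (h * a) = (chB p ℬ χ₁ a : ℬ) * g h)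
    (h0 : g ⟨-w₀, 0⟩ = 0) : g = 0 := by
  have : Finite W := Module.finite_of_finite F
  have : Fintype ↥(A₁ ⊓ A₂) := Fintype.ofFinite _
  funext ⟨w, t⟩
  by_cases hmem : w₀ + w ∈ A₁ ⊔ A₂
  · obtain ⟨a, ha, b, hb, hab⟩ := AddSubgroup.mem_sup.1 hmem
    obtain rfl : w = b + -w₀ + a := by
      rw [← add_right_inj w₀, ← hab]
      abel
    have hprod : (⟨b + -w₀ + a, t⟩ : Heis β) = ⟨b, 0⟩ * ⟨-w₀, 0⟩ *
        ⟨a, t - (2 : F)⁻¹ * β b (-w₀) - (2 : F)⁻¹ * β (b + -w₀) a⟩ := by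
      ext
      · simp
      · simp only [Heis.mul_w, Heis.mul_t]
        ring
    rw [hprod, hg₁ _ ha, hg _ hb, h0]
    simp
  · have hneg : ∀ x y : W, β x y = -β y x := fun x y => (LinearMap.IsAlt.neg halt y x).symm
    have hψneg : ∀ x, ψ (-x) = (ψ x)⁻¹ := fun x => by
      rw [eq_inv_iff_mul_eq_one, ← hψ, neg_add_cancel, map_zero_of_map_add hψ]
    have hperp : ∀ x, (∀ b ∈ A₁ ⊔ A₂, ψ (β x b) = 1) ↔ x ∈ A₁ ⊓ A₂ := by
      intro x
      rw [AddSubgroup.mem_inf, ← hm₁.perp, ← hm₂.perp]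
      constructor
      · exact fun h => ⟨fun a ha => h a (AddSubgroup.mem_sup_left ha),
          fun a ha => h a (AddSubgroup.mem_sup_right ha)⟩
      · rintro ⟨h1, h2⟩ b hb
        obtain ⟨y, hy, z, hz, rfl⟩ := AddSubgroup.mem_sup.1 hb
        rw [map_add, hψ, h1 y hy, h2 z hz, one_mul]
    have hex : ∃ a ∈ A₁ ⊓ A₂, ψ (β (w₀ + w) a) ≠ 1 := by
      by_contra! h
      refine hmem (mem_of_perp_perp halt hnd hψ hψnt _ _ hperp fun x hx => ?_)
      rw [hneg, hψneg, h x hx, inv_one]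
    have hsum := congrArg (algebraMap (AA p) ℬ)
      (sum_addSubgroup_eq_zero hψ (A₁ ⊓ A₂) (β (w₀ + w)) hex)
    rw [map_sum, map_zero] at hsum
    have hfix : ∀ a : ↥(A₁ ⊓ A₂),
        algebraMap (AA p) ℬ (ψ (β (w₀ + w) a)) * g ⟨w, t⟩ = g ⟨w, t⟩ := by
      rintro ⟨a, ha⟩
      obtain ⟨ha1, ha2⟩ := AddSubgroup.mem_inf.1 ha
      have hcomm : (⟨w, t⟩ * ⟨a, 0⟩ : Heis β) = ⟨a, β w a + 0⟩ * ⟨w, t⟩ := by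
        ext
        · simp [add_comm]
        · simp only [Heis.mul_t, hneg a w]
          field_simp
          ring
      have h1 := hg₁ ⟨a, 0⟩ ha1 ⟨w, t⟩
      rw [hcomm, hg _ ha2, hm₂.chB_mk_add ha2, hw a ha1 ha2, mul_comm (psB p ℬ ψ _),
        Units.val_mul, Units.val_mul, mul_assoc, mul_assoc, Units.mul_right_inj] at h1
      change (psB p ℬ ψ (β (w₀ + w) a) : ℬ) * _ = _
      rw [map_add, LinearMap.add_apply, psB_add hψ, Units.val_mul, mul_assoc, h1, ← mul_assoc,
        ← Units.val_mul, ← psB_add hψ, hneg w₀ a, neg_add_cancel, psB_zero hψ, Units.val_one,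
        one_mul]
    have hcard : (Nat.card ↥(A₁ ⊓ A₂) : ℬ) * g ⟨w, t⟩ = 0 := by
      rw [Nat.card_eq_fintype_card, ← nsmul_eq_mul, ← Finset.card_univ, ← Finset.sum_const,
        ← Finset.sum_congr rfl fun a _ => hfix a, ← Finset.sum_mul, hsum, zero_mul]
    exact (isUnit_natCard_addSubgroup p ℬ F (A₁ ⊓ A₂)).mul_right_eq_zero.1 hcard

/-- An intertwiner is determined by the value at `-w₀` of the image of the generator. -/
lemma intertwiner_ext (halt : ∀ v : W, β v v = 0)
    (hnd : ∀ v : W, (∀ u : W, β v u = 0) → v = 0) (h2F : (2 : F) ≠ 0)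
    (hψ : ∀ x y : F, ψ (x + y) = ψ x * ψ y) (hψnt : ∃ x : F, ψ x ≠ 1)
    (hm₁ : IsModel ψ A₁ χ₁) (hm₂ : IsModel ψ A₂ χ₂) (hw : IsTwist p ℬ ψ A₁ A₂ χ₁ χ₂ w₀)
    {S T : ↥(IndV β ℬ A₁ (chB p ℬ χ₁)) →ₗ[ℬ] ↥(IndV β ℬ A₂ (chB p ℬ χ₂))}
    (hS : ∀ h₀ f, S (hActV β ℬ A₁ (chB p ℬ χ₁) h₀ f) = hActV β ℬ A₂ (chB p ℬ χ₂) h₀ (S f))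
    (hT : ∀ h₀ f, T (hActV β ℬ A₁ (chB p ℬ χ₁) h₀ f) = hActV β ℬ A₂ (chB p ℬ χ₂) h₀ (T f))
    (hST : (S (deltaV hm₁) : Heis β → ℬ) ⟨-w₀, 0⟩ = (T (deltaV hm₁) : Heis β → ℬ) ⟨-w₀, 0⟩) :
    S = T := by
  have : Finite W := Module.finite_of_finite F
  have : Fintype W := Fintype.ofFinite W
  have hδ : S (deltaV hm₁) = T (deltaV hm₁) := by
    rw [← sub_eq_zero]
    refine Subtype.ext (eq_zero_of_apply_neg_eq_zero halt hnd h2F hψ hψnt hm₁ hm₂ hw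
      (S (deltaV hm₁) - T (deltaV hm₁)).2 (fun a ha h => ?_) (sub_eq_zero.2 hST))
    have h1 : hActV β ℬ A₂ (chB p ℬ χ₂) a (S (deltaV hm₁) - T (deltaV hm₁)) =
        (chB p ℬ χ₁ a : ℬ) • (S (deltaV hm₁) - T (deltaV hm₁)) := by
      rw [map_sub, ← hS, ← hT, hActV_deltaV hm₁ ha, map_smul, map_smul, smul_sub]
    exact congrFun (congrArg Subtype.val h1) h
  ext1 f
  have hu := isUnit_natCard_addSubgroup p ℬ F A₁
  rw [← hu.smul_left_cancel, ← map_smul, ← map_smul, natCard_smul_eq_sum_hActV_deltaV hm₁ f]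
  simp only [map_sum, map_smul, hS, hT, hδ]

lemma fullSumV_comp_fullSumV [Fintype A₁] [Fintype A₂] (halt : ∀ v : W, β v v = 0)
    (hnd : ∀ v : W, (∀ u : W, β v u = 0) → v = 0) (h2F : (2 : F) ≠ 0)
    (hψ : ∀ x y : F, ψ (x + y) = ψ x * ψ y) (hψnt : ∃ x : F, ψ x ≠ 1)
    (hm₁ : IsModel ψ A₁ χ₁) (hm₂ : IsModel ψ A₂ χ₂) (hw : IsTwist p ℬ ψ A₁ A₂ χ₁ χ₂ w₀) :
    (fullSumV (ℬ := ℬ) hm₂ hm₁ (-w₀)).comp (fullSumV hm₁ hm₂ w₀) =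
      ((Nat.card A₁ : ℬ) * (Nat.card ↥(A₁ ⊓ A₂) : ℬ)) • LinearMap.id := by
  refine intertwiner_ext halt hnd h2F hψ hψnt hm₁ hm₁ (isTwist_refl hψ)
    (fun h₀ f => ?_) (fun h₀ f => ?_) ?_
  · simp only [LinearMap.comp_apply, fullSumV_hActV]
  · simp
  · have hδ : deltaFun A₁ (chB p ℬ χ₁) ⟨-0, 0⟩ = (1 : ℬ) := by
      simp [deltaFun, A₁.zero_mem, hm₁.chB_central, psB_zero hψ]
    have hterm : ∀ a : A₁, ((chB p ℬ χ₁ ⟨a, 0⟩)⁻¹ : ℬˣ) *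
        (fullSumV (ℬ := ℬ) hm₁ hm₂ w₀ (deltaV hm₁)).1 (⟨-w₀, 0⟩ * ⟨a, 0⟩ * ⟨-0, 0⟩) =
          (Nat.card ↥(A₁ ⊓ A₂) : ℬ) := by
      intro a
      have h1 := fullSumV_hActV (ℬ := ℬ) hm₁ hm₂ w₀ ⟨a, 0⟩ (deltaV hm₁)
      rw [hActV_deltaV hm₁ a.2, map_smul] at h1
      have h2 := congrFun (congrArg Subtype.val h1) (⟨-w₀, 0⟩ : Heis β)
      have hone : (⟨-0, 0⟩ : Heis β) = 1 := by ext <;> simp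
      rw [hone, mul_one]
      refine (congrArg _ h2.symm).trans ?_
      rw [Submodule.coe_smul, Pi.smul_apply, smul_eq_mul, Units.inv_mul_cancel_left]
      exact fullSum_deltaFun halt h2F hψ hm₁ hw
    refine (Finset.sum_congr rfl fun a _ => hterm a).trans ?_
    rw [Finset.sum_const, Finset.card_univ, ← Nat.card_eq_fintype_card, nsmul_eq_mul]
    exact (mul_one _).symm.trans (congrArg _ hδ.symm)

lemma fullSumV_bijective [Fintype A₁] [Fintype A₂] (halt : ∀ v : W, β v v = 0)
    (hnd : ∀ v : W, (∀ u : W, β v u = 0) → v = 0) (h2F : (2 : F) ≠ 0)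
    (hψ : ∀ x y : F, ψ (x + y) = ψ x * ψ y) (hψnt : ∃ x : F, ψ x ≠ 1)
    (hm₁ : IsModel ψ A₁ χ₁) (hm₂ : IsModel ψ A₂ χ₂) (hw : IsTwist p ℬ ψ A₁ A₂ χ₁ χ₂ w₀) :
    Function.Bijective (fullSumV (ℬ := ℬ) hm₁ hm₂ w₀) := by
  have h1 := fullSumV_comp_fullSumV (ℬ := ℬ) halt hnd h2F hψ hψnt hm₁ hm₂ hw
  have h2 := fullSumV_comp_fullSumV (ℬ := ℬ) halt hnd h2F hψ hψnt hm₂ hm₁ (hw.symm hψ)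
  rw [neg_neg] at h2
  have hu : ∀ B C : AddSubgroup W, IsUnit ((Nat.card B : ℬ) * (Nat.card C : ℬ)) := fun B C =>
    (isUnit_natCard_addSubgroup p ℬ F B).mul (isUnit_natCard_addSubgroup p ℬ F C)
  constructor
  · refine Function.Injective.of_comp (f := fullSumV (ℬ := ℬ) hm₂ hm₁ (-w₀)) ?_
    rw [← LinearMap.coe_comp, h1]
    exact fun x y hxy => (hu _ _).smul_left_cancel.1 hxy
  · refine Function.Surjective.of_comp (g := fullSumV (ℬ := ℬ) hm₂ hm₁ (-w₀)) ?_
    rw [← LinearMap.coe_comp, h2]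
    intro y
    obtain ⟨u, hu'⟩ := hu A₂ (A₂ ⊓ A₁)
    refine ⟨((u⁻¹ : ℬˣ) : ℬ) • y, ?_⟩
    rw [← hu', LinearMap.smul_apply, LinearMap.id_apply, smul_smul, Units.mul_inv, one_smul]

end Finite

end Models

/-- Change of model from `V_{A₁}^ℬ` to `V_{A₂}^ℬ` : the intertwining
integral is well defined, is an isomorphism of `ℬ[H]`-modules, and spans the rank-one
free `ℬ`-module `Hom_{ℬ[H]}(V_{A₁}^ℬ, V_{A₂}^ℬ)`. -/
theorem statement_3
    (p : ℕ+) [Fact (Nat.Prime (p : ℕ))] (hp2 : (p : ℕ) ≠ 2)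
    {F : Type*} [Field F] [Fintype F] [CharP F (p : ℕ)]
    {W : Type*} [AddCommGroup W] [Module F W] [FiniteDimensional F W]
    (β : W →ₗ[F] W →ₗ[F] F)
    (halt : ∀ v : W, β v v = 0)
    (hnd : ∀ v : W, (∀ u : W, β v u = 0) → v = 0)
    (ℬ : Type*) [CommRing ℬ] [Algebra (AA p) ℬ]
    (ψ : F → (AA p)ˣ) (hψ : ∀ x y : F, ψ (x + y) = ψ x * ψ y)
    (hψnt : ∃ x : F, ψ x ≠ 1)
    (A₁ A₂ : AddSubgroup W)
    (hA₁ : ∀ v : W, (∀ a ∈ A₁, ψ (β v a) = 1) ↔ v ∈ A₁)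
    (hA₂ : ∀ v : W, (∀ a ∈ A₂, ψ (β v a) = 1) ↔ v ∈ A₂)
    (ψA₁ ψA₂ : Heis β → (AA p)ˣ)
    (hψA₁ : ∀ a b : Heis β, a.w ∈ A₁ → b.w ∈ A₁ → ψA₁ (a * b) = ψA₁ a * ψA₁ b)
    (hψA₁ext : ∀ t : F, ψA₁ ⟨0, t⟩ = ψ t)
    (hψA₂ : ∀ a b : Heis β, a.w ∈ A₂ → b.w ∈ A₂ → ψA₂ (a * b) = ψA₂ a * ψA₂ b)
    (hψA₂ext : ∀ t : F, ψA₂ ⟨0, t⟩ = ψ t)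
    -- the twisting element ω ∈ W
    (w₀ : W)
    (hw₀ : ∀ a : W, a ∈ A₁ → a ∈ A₂ →
      (chB p ℬ ψA₁ (⟨a, 0⟩ : Heis β) : ℬ) * ((chB p ℬ ψA₂ (⟨a, 0⟩ : Heis β))⁻¹ : ℬˣ) =
        (psB p ℬ ψ (β a w₀) : ℬ))
    -- a set of representatives for the cosets (A₁ ∩ A₂)\A₂
    (R : Finset W) (hR₁ : ∀ r ∈ R, r ∈ A₂)
    (hR₂ : ∀ a ∈ A₂, ∃! r : W, r ∈ R ∧ a - r ∈ A₁) :
    -- (i) the summand only depends on the coset (A₁ ∩ A₂)a of a ∈ A₂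
    (∀ f ∈ IndV β ℬ A₁ (chB p ℬ ψA₁), ∀ h : Heis β, ∀ a a' : W,
      a ∈ A₂ → a' ∈ A₂ → a - a' ∈ A₁ →
      ((chB p ℬ ψA₂ (⟨a, 0⟩ : Heis β))⁻¹ : ℬˣ) *
          f ((⟨w₀, 0⟩ : Heis β) * (⟨a, 0⟩ : Heis β) * h) =
        ((chB p ℬ ψA₂ (⟨a', 0⟩ : Heis β))⁻¹ : ℬˣ) *
          f ((⟨w₀, 0⟩ : Heis β) * (⟨a', 0⟩ : Heis β) * h)) ∧
    -- (ii) and (iii)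
    (∃ Φ : ↥(IndV β ℬ A₁ (chB p ℬ ψA₁)) →ₗ[ℬ] ↥(IndV β ℬ A₂ (chB p ℬ ψA₂)),
      (∀ (f : ↥(IndV β ℬ A₁ (chB p ℬ ψA₁))) (h : Heis β),
        (Φ f : Heis β → ℬ) h =
          ∑ a ∈ R, ((chB p ℬ ψA₂ (⟨a, 0⟩ : Heis β))⁻¹ : ℬˣ) *
            (f : Heis β → ℬ) ((⟨w₀, 0⟩ : Heis β) * (⟨a, 0⟩ : Heis β) * h)) ∧
      Function.Bijective Φ ∧
      (∀ (h₀ : Heis β) (f : ↥(IndV β ℬ A₁ (chB p ℬ ψA₁))),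
        Φ (hActV β ℬ A₁ (chB p ℬ ψA₁) h₀ f) = hActV β ℬ A₂ (chB p ℬ ψA₂) h₀ (Φ f)) ∧
      (∀ T : ↥(IndV β ℬ A₁ (chB p ℬ ψA₁)) →ₗ[ℬ] ↥(IndV β ℬ A₂ (chB p ℬ ψA₂)),
        (∀ (h₀ : Heis β) (f : ↥(IndV β ℬ A₁ (chB p ℬ ψA₁))),
          T (hActV β ℬ A₁ (chB p ℬ ψA₁) h₀ f) = hActV β ℬ A₂ (chB p ℬ ψA₂) h₀ (T f)) →
        ∃! c : ℬ, T = c • Φ)) := by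
  have : Finite W := Module.finite_of_finite F
  have : Fintype A₁ := Fintype.ofFinite _
  have : Fintype A₂ := Fintype.ofFinite _
  have h2F : (2 : F) ≠ 0 := Ring.two_ne_zero (by rwa [ringChar.eq F (p : ℕ)])
  have hm₁ : IsModel ψ A₁ ψA₁ := ⟨hA₁, hψA₁, hψA₁ext⟩
  have hm₂ : IsModel ψ A₂ ψA₂ := ⟨hA₂, hψA₂, hψA₂ext⟩
  have hw : IsTwist p ℬ ψ A₁ A₂ ψA₁ ψA₂ w₀ := fun a h1 h2 => by
    rw [mul_comm (chB p ℬ ψA₂ _), ← mul_inv_eq_iff_eq_mul]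
    exact Units.ext (hw₀ a h1 h2)
  obtain ⟨u, hu⟩ := isUnit_natCard_addSubgroup p ℬ F (A₁ ⊓ A₂)
  have hcoset : ∀ f ∈ IndV β ℬ A₁ (chB p ℬ ψA₁), ∀ h : Heis β, ∀ a a' : W,
      a ∈ A₂ → a' ∈ A₂ → a - a' ∈ A₁ →
      ((chB p ℬ ψA₂ (⟨a, 0⟩ : Heis β))⁻¹ : ℬˣ) *
          f ((⟨w₀, 0⟩ : Heis β) * (⟨a, 0⟩ : Heis β) * h) =
        ((chB p ℬ ψA₂ (⟨a', 0⟩ : Heis β))⁻¹ : ℬˣ) *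
          f ((⟨w₀, 0⟩ : Heis β) * (⟨a', 0⟩ : Heis β) * h) :=
    fun f hf h a a' ha ha' haa =>
      hm₁.inv_mul_apply_eq halt h2F hψ hm₂ hw hf h ha ha' haa
  have hΦ : ∀ h₀ f, (((u⁻¹ : ℬˣ) : ℬ) • fullSumV (ℬ := ℬ) hm₁ hm₂ w₀)
        (hActV β ℬ A₁ (chB p ℬ ψA₁) h₀ f) =
      hActV β ℬ A₂ (chB p ℬ ψA₂) h₀ ((((u⁻¹ : ℬˣ) : ℬ) • fullSumV hm₁ hm₂ w₀) f) :=
    fun h₀ f => by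
      rw [LinearMap.smul_apply, LinearMap.smul_apply, fullSumV_hActV, map_smul]
  have hΦδ : (((((u⁻¹ : ℬˣ) : ℬ) • fullSumV (ℬ := ℬ) hm₁ hm₂ w₀) (deltaV hm₁) :
      ↥(IndV β ℬ A₂ (chB p ℬ ψA₂))) : Heis β → ℬ) ⟨-w₀, 0⟩ = 1 := by
    rw [LinearMap.smul_apply, Submodule.coe_smul, Pi.smul_apply, smul_eq_mul,
      Units.inv_mul_eq_iff_eq_mul, mul_one, hu]
    exact fullSum_deltaFun halt h2F hψ hm₁ hw
  refine ⟨hcoset, ((u⁻¹ : ℬˣ) : ℬ) • fullSumV hm₁ hm₂ w₀, fun f h => ?_, ?_, hΦ, fun T hT => ?_⟩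
  · have hsum := sum_eq_natCard_mul_sum_representatives hR₁ hR₂ (hcoset f f.2 h)
    rw [← hu] at hsum
    exact (congrArg _ hsum).trans (Units.inv_mul_cancel_left u _)
  · have hbij := fullSumV_bijective (ℬ := ℬ) halt hnd h2F hψ hψnt hm₁ hm₂ hw
    exact (MulAction.bijective u⁻¹).comp hbij
  · refine ⟨(T (deltaV hm₁) : Heis β → ℬ) ⟨-w₀, 0⟩, ?_, fun c hc => ?_⟩
    · refine intertwiner_ext halt hnd h2F hψ hψnt hm₁ hm₂ hw hT (fun h₀ f => ?_) ?_
      · exact (congrArg _ (hΦ h₀ f)).trans (map_smul _ _ _).symm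
      · rw [LinearMap.smul_apply, Submodule.coe_smul, Pi.smul_apply, hΦδ, smul_eq_mul, mul_one]
    · rw [hc, LinearMap.smul_apply, Submodule.coe_smul, Pi.smul_apply, hΦδ, smul_eq_mul, mul_one]
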